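/- Let d ≥ 2, let 0 < r_1 < r_2 < ... < r_N be positive real numbers, and let F be a real-valued function of class C^2 on the closed annulus {x ∈ ℝ^d : r_1 ≤ |x| ≤ r_N}. Suppose I_2(F) is a harmonic spline for the partition A(r_1,r_2), ..., A(r_{N-1},r_N) (i.e. I_2(F) is continuous on the closed annulus {r_1 ≤ |x| ≤ r_N} and harmonic on each open annulus A(r_j,r_{j+1})) which satisfies I_2(F)(x) = F(x) for every x with |x| = r_j, j = 1,...,N. Then sup over A(r_1,r_N) of |F - I_2(F)| ≤ C_d · max_{j=1,...,N-1} (r_{j+1} - r_j)^2 · sup over A(r_1,r_N) of |ΔF|, where C_d = max{1/(2d), 1/8}. -/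

import Mathlib

open MeasureTheory Metric Set Filter Topology

noncomputable section

/-- The Laplace operator `Δf = ∑ ∂²f/∂xᵢ²` on `ℝᵈ`. -/
def laplacian {d : ℕ} {V : Type*} [NormedAddCommGroup V] [NormedSpace ℝ V]
    (f : EuclideanSpace ℝ (Fin d) → V) (x : EuclideanSpace ℝ (Fin d)) : V :=
  ∑ i : Fin d, iteratedFDeriv ℝ 2 f x ![EuclideanSpace.single i 1, EuclideanSpace.single i 1]

/-- The open annulus `A(r,R) = {x ∈ ℝᵈ : r < |x| < R}`. -/
def annulus (d : ℕ) (r R : ℝ) : Set (EuclideanSpace ℝ (Fin d)) := {x | r < ‖x‖ ∧ ‖x‖ < R}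

/-- The closed annulus `{x ∈ ℝᵈ : r ≤ |x| ≤ R}`. -/
def closedAnnulus (d : ℕ) (r R : ℝ) : Set (EuclideanSpace ℝ (Fin d)) := {x | r ≤ ‖x‖ ∧ ‖x‖ ≤ R}

/-- A function is harmonic on an open set `U` if it is `C²` there and `Δf = 0` on `U`. -/
def HarmonicOn {d : ℕ} (f : EuclideanSpace ℝ (Fin d) → ℝ)
    (U : Set (EuclideanSpace ℝ (Fin d))) : Prop :=
  ContDiffOn ℝ 2 f U ∧ ∀ x ∈ U, laplacian f x = 0

/-- A harmonic spline for the partition `A(r 0, r 1), ..., A(r (n-1), r n)`: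
continuous on the closed annulus and harmonic on each open subannulus. -/
def HarmonicSpline (d n : ℕ) (r : Fin (n + 1) → ℝ)
    (S : EuclideanSpace ℝ (Fin d) → ℝ) : Prop :=
  ContinuousOn S (closedAnnulus d (r 0) (r (Fin.last n))) ∧
  ∀ i : Fin n, HarmonicOn S (annulus d (r i.castSucc) (r i.succ))


theorem secondDeriv_nonpos_of_isLocalMax {φ : ℝ → ℝ} {a : ℝ} (h : IsLocalMax φ a)
    (hc : ContinuousAt φ a) : deriv (deriv φ) a ≤ 0 := by
  by_contra! hpos
  have hmin := isLocalMin_of_deriv_deriv_pos hpos h.deriv_eq_zero hc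
  have hconst : φ =ᶠ[𝓝 a] fun _ ↦ φ a := by
    filter_upwards [h, hmin] with x h1 h2 using le_antisymm h1 h2
  rw [hconst.deriv.deriv_eq] at hpos
  simp at hpos

theorem iteratedFDeriv_two_eq_deriv_deriv_line {E : Type*} [NormedAddCommGroup E] [NormedSpace ℝ E]
    {f : E → ℝ} {x : E} (hf : ContDiffAt ℝ 2 f x) (e : E) :
    iteratedFDeriv ℝ 2 f x ![e, e] = deriv (deriv fun t : ℝ ↦ f (x + t • e)) 0 := by
  have hline : ∀ t : ℝ, HasDerivAt (fun t : ℝ ↦ x + t • e) e t := fun t ↦ by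
    simpa using ((hasDerivAt_id t).smul_const e).const_add x
  have htend : Tendsto (fun t : ℝ ↦ x + t • e) (𝓝 0) (𝓝 x) := by
    simpa using (hline 0).continuousAt.tendsto
  have hfirst : deriv (fun t : ℝ ↦ f (x + t • e)) =ᶠ[𝓝 0] fun t ↦ fderiv ℝ f (x + t • e) e := by
    filter_upwards [htend.eventually (hf.eventually (by simp))] with t ht
    exact ((ht.differentiableAt (by simp)).hasFDerivAt.comp_hasDerivAt t (hline t)).deriv
  have hsecond : HasFDerivAt (fderiv ℝ f) (fderiv ℝ (fderiv ℝ f) x) (x + (0 : ℝ) • e) := by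
    simpa using ((hf.fderiv_right (m := 1) (by norm_num)).differentiableAt (by simp)).hasFDerivAt
  rw [hfirst.deriv_eq, iteratedFDeriv_two_apply]
  have hpath : HasDerivAt (fun t : ℝ ↦ fderiv ℝ f (x + t • e)) (fderiv ℝ (fderiv ℝ f) x e) 0 :=
    hsecond.comp_hasDerivAt 0 (hline 0)
  have hsecondDeriv : HasDerivAt (fun t : ℝ ↦ fderiv ℝ f (x + t • e) e)
      (fderiv ℝ (fderiv ℝ f) x e e) 0 := by
    simpa using hpath.clm_apply (hasDerivAt_const (0 : ℝ) e)
  exact hsecondDeriv.deriv.symm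

theorem laplacian_nonpos_of_isLocalMax {d : ℕ} {f : EuclideanSpace ℝ (Fin d) → ℝ}
    {x : EuclideanSpace ℝ (Fin d)} (hf : ContDiffAt ℝ 2 f x) (h : IsLocalMax f x) :
    laplacian f x ≤ 0 := by
  refine Finset.sum_nonpos fun i _ ↦ ?_
  rw [iteratedFDeriv_two_eq_deriv_deriv_line hf]
  have hc : ContinuousAt (fun t : ℝ ↦ x + t • (EuclideanSpace.single i 1 :
    EuclideanSpace ℝ (Fin d))) 0 := by fun_prop
  refine secondDeriv_nonpos_of_isLocalMax ?_ ?_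
  · have := h
    rw [IsLocalMax, IsMaxFilter] at this ⊢
    have ht := hc.tendsto
    simp only [zero_smul, add_zero] at ht ⊢
    exact ht.eventually this
  · refine ContinuousAt.comp (f := fun t : ℝ ↦ x + t • (EuclideanSpace.single i 1 :
      EuclideanSpace ℝ (Fin d))) ?_ hc
    simpa using hf.continuousAt

theorem laplacian_sub {d : ℕ} {f g : EuclideanSpace ℝ (Fin d) → ℝ} {x : EuclideanSpace ℝ (Fin d)}
    (hf : ContDiffAt ℝ 2 f x) (hg : ContDiffAt ℝ 2 g x) :
    laplacian (fun y ↦ f y - g y) x = laplacian f x - laplacian g x := by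
  have h : iteratedFDeriv ℝ 2 (fun y ↦ f y - g y) x =
      iteratedFDeriv ℝ 2 f x - iteratedFDeriv ℝ 2 g x := iteratedFDeriv_sub_apply hf hg
  simp only [laplacian, ← Finset.sum_sub_distrib, h, _root_.sub_apply]

theorem laplacian_const_mul {d : ℕ} {f : EuclideanSpace ℝ (Fin d) → ℝ}
    {x : EuclideanSpace ℝ (Fin d)} (hf : ContDiffAt ℝ 2 f x) (c : ℝ) :
    laplacian (fun y ↦ c * f y) x = c * laplacian f x := by
  have h : iteratedFDeriv ℝ 2 (fun y ↦ c * f y) x = c • iteratedFDeriv ℝ 2 f x :=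
    iteratedFDeriv_const_smul_apply (a := c) hf
  simp only [laplacian, h, Finset.mul_sum, _root_.smul_apply, smul_eq_mul]

theorem contDiffAt_radial_barrier {d : ℕ} (A B p : ℝ) {x : EuclideanSpace ℝ (Fin d)} (hx : x ≠ 0) :
    ContDiffAt ℝ 2 (fun y : EuclideanSpace ℝ (Fin d) ↦
      A - ‖y‖ ^ 2 / (2 * d) - B * (‖y‖ ^ 2) ^ p) x := by
  have h : ContDiffAt ℝ 2 (fun y : EuclideanSpace ℝ (Fin d) ↦ ‖y‖ ^ 2) x :=
    (contDiff_norm_sq ℝ).contDiffAt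
  exact (contDiffAt_const.sub (h.div_const _)).sub
    (contDiffAt_const.mul (h.rpow_const_of_ne (by simpa using hx)))

theorem laplacian_radial_barrier {d : ℕ} (hd : d ≠ 0) (A B p : ℝ) {x : EuclideanSpace ℝ (Fin d)}
    (hx : x ≠ 0) :
    laplacian (fun y : EuclideanSpace ℝ (Fin d) ↦ A - ‖y‖ ^ 2 / (2 * d) - B * (‖y‖ ^ 2) ^ p) x =
      -1 - 2 * B * (p * (2 * p - 2 + d)) * (‖x‖ ^ 2) ^ (p - 1) := by
  have hxpos : 0 < ‖x‖ ^ 2 := by positivity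
  have hsecond : ∀ i : Fin d, iteratedFDeriv ℝ 2 (fun y : EuclideanSpace ℝ (Fin d) ↦
      A - ‖y‖ ^ 2 / (2 * d) - B * (‖y‖ ^ 2) ^ p) x
        ![EuclideanSpace.single i 1, EuclideanSpace.single i 1] =
      -1 / d - 2 * B * p * (‖x‖ ^ 2) ^ (p - 1) -
        4 * B * p * (p - 1) * (‖x‖ ^ 2) ^ (p - 2) * x i ^ 2 := fun i ↦ by
    rw [iteratedFDeriv_two_eq_deriv_deriv_line (contDiffAt_radial_barrier A B p hx)]
    have hnorm : ∀ t : ℝ, ‖x + t • (EuclideanSpace.single i 1 : EuclideanSpace ℝ (Fin d))‖ ^ 2 =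
        ‖x‖ ^ 2 + 2 * t * x i + t ^ 2 := fun t ↦ by
      rw [norm_add_sq_real, inner_smul_right, norm_smul]
      simp [EuclideanSpace.inner_single_right]
      ring
    simp only [hnorm]
    have hq : ∀ t : ℝ, HasDerivAt (fun t : ℝ ↦ ‖x‖ ^ 2 + 2 * t * x i + t ^ 2)
        (2 * x i + 2 * t) t := fun t ↦ by
      refine (((((hasDerivAt_id t).const_mul 2).mul_const (x i)).const_add (‖x‖ ^ 2)).add
        ((hasDerivAt_id t).pow 2)).congr_deriv ?_
      simp
    have hpos : ∀ᶠ t : ℝ in 𝓝 0, ‖x‖ ^ 2 + 2 * t * x i + t ^ 2 ≠ 0 :=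
      (hq 0).continuousAt.eventually_ne (by simpa using hx)
    have hfirst : deriv (fun t : ℝ ↦ A - (‖x‖ ^ 2 + 2 * t * x i + t ^ 2) / (2 * d) -
        B * (‖x‖ ^ 2 + 2 * t * x i + t ^ 2) ^ p) =ᶠ[𝓝 0] fun t ↦ -(2 * x i + 2 * t) / (2 * d) -
          B * ((2 * x i + 2 * t) * p * (‖x‖ ^ 2 + 2 * t * x i + t ^ 2) ^ (p - 1)) := by
      filter_upwards [hpos] with t ht
      refine (((((hq t).div_const (2 * d)).const_sub A).sub
        (((hq t).rpow_const (p := p) (Or.inl ht)).const_mul B)).congr_deriv ?_).deriv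
      ring
    rw [hfirst.deriv_eq]
    have hl : HasDerivAt (fun t : ℝ ↦ 2 * x i + 2 * t) 2 0 := by
      simpa using ((hasDerivAt_id (0 : ℝ)).const_mul 2).const_add (2 * x i)
    refine (((hl.neg.div_const (2 * d)).sub (((hl.mul_const p).mul
      ((hq 0).rpow_const (p := p - 1) (Or.inl hpos.self_of_nhds))).const_mul B)).congr_deriv
        ?_).deriv
    have hd' : (d : ℝ) ≠ 0 := by exact_mod_cast hd
    rw [show p - 1 - 1 = p - 2 by ring]
    simp
    field_simp
    ring
  simp only [laplacian, hsecond]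
  rw [Finset.sum_sub_distrib, ← Finset.mul_sum, ← EuclideanSpace.real_norm_sq_eq,
    Finset.sum_const, Finset.card_univ, Fintype.card_fin, nsmul_eq_mul]
  have hd' : (d : ℝ) ≠ 0 := by exact_mod_cast hd
  have hmul : (‖x‖ ^ 2) ^ (p - 1) = (‖x‖ ^ 2) ^ (p - 2) * ‖x‖ ^ 2 := by
    rw [← Real.rpow_add_one hxpos.ne']
    ring_nf
  rw [mul_assoc _ _ (‖x‖ ^ 2), ← hmul]
  field_simp
  ring

theorem isOpen_annulus (d : ℕ) (r R : ℝ) : IsOpen (annulus d r R) :=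
  (isOpen_lt continuous_const continuous_norm).inter (isOpen_lt continuous_norm continuous_const)

theorem isCompact_closedAnnulus (d : ℕ) (r R : ℝ) : IsCompact (closedAnnulus d r R) := by
  refine (isCompact_closedBall (0 : EuclideanSpace ℝ (Fin d)) R).of_isClosed_subset
    ((isClosed_le continuous_const continuous_norm).inter
      (isClosed_le continuous_norm continuous_const)) fun x hx ↦ ?_
  simpa using hx.2

theorem annulus_subset_closedAnnulus (d : ℕ) (r R : ℝ) : annulus d r R ⊆ closedAnnulus d r R :=
  fun _ hx ↦ ⟨hx.1.le, hx.2.le⟩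

/-- Equivalently, `x ↦ x coth x` is increasing. -/
theorem two_mul_cosh_mul_sinh_le {k t : ℝ} (hk : 2 ≤ k) (ht : 0 ≤ t) :
    2 * Real.cosh (2 * t) * Real.sinh (k * t) ≤ k * Real.cosh (k * t) * Real.sinh (2 * t) := by
  have hderiv : ∀ x : ℝ, HasDerivAt
      (fun x ↦ k * Real.cosh (k * x) * Real.sinh (2 * x) -
        2 * Real.cosh (2 * x) * Real.sinh (k * x))
      ((k ^ 2 - 4) * (Real.sinh (k * x) * Real.sinh (2 * x))) x := fun x ↦ by
    have h1 : HasDerivAt (fun x : ℝ ↦ k * x) k x := by simpa using (hasDerivAt_id x).const_mul k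
    have h2 : HasDerivAt (fun x : ℝ ↦ 2 * x) 2 x := by
      simpa using (hasDerivAt_id x).const_mul (2 : ℝ)
    refine (((h1.cosh.const_mul k).mul h2.sinh).sub
      ((h2.cosh.const_mul 2).mul h1.sinh)).congr_deriv ?_
    ring
  have hmono := monotoneOn_of_deriv_nonneg (convex_Ici (0 : ℝ))
    (fun x _ ↦ (hderiv x).continuousAt.continuousWithinAt)
    (fun x _ ↦ (hderiv x).differentiableAt.differentiableWithinAt) (fun x hx ↦ by
      rw [interior_Ici, mem_Ioi] at hx
      rw [(hderiv x).deriv]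
      have h1 : 0 ≤ Real.sinh (k * x) := Real.sinh_nonneg_iff.2 (by positivity)
      have h2 : 0 ≤ Real.sinh (2 * x) := Real.sinh_nonneg_iff.2 (by positivity)
      have h3 : 0 ≤ k ^ 2 - 4 := by nlinarith
      positivity)
  have := hmono self_mem_Ici (mem_Ici.2 ht) ht
  simp only [mul_zero, Real.sinh_zero] at this
  linarith

theorem tendsto_sinh_mul_div_self (a : ℝ) :
    Tendsto (fun t : ℝ ↦ Real.sinh (a * t) / t) (𝓝[>] 0) (𝓝 a) := by
  have h1 : HasDerivAt (fun x : ℝ ↦ a * x) a 0 := by simpa using (hasDerivAt_id (0 : ℝ)).const_mul a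
  have h := (hasDerivAt_iff_tendsto_slope_zero.1 h1.sinh).mono_left
    (nhdsGT_le_nhdsNE 0)
  simpa [div_eq_inv_mul] using h

theorem sinh_mul_coth_add_log_le {k t : ℝ} (hk : 2 ≤ k) (ht : 0 < t) :
    k * Real.sinh (2 * t) * Real.cosh (k * t) / Real.sinh (k * t) +
      2 * Real.log (2 * Real.sinh (k * t) / (k * Real.sinh (2 * t))) ≤
      2 + k ^ 2 * Real.sinh t ^ 2 := by
  have hk0 : 0 < k := by linarith
  set H : ℝ → ℝ := fun t ↦ 2 + k ^ 2 * Real.sinh t ^ 2 -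
    k * Real.sinh (2 * t) * Real.cosh (k * t) / Real.sinh (k * t) -
      2 * Real.log (2 * Real.sinh (k * t) / (k * Real.sinh (2 * t))) with hH
  have hderiv : ∀ x : ℝ, 0 < x → HasDerivAt H (Real.sinh (2 * x) *
      (k * Real.cosh (k * x) / Real.sinh (k * x) - 2 * Real.cosh (2 * x) / Real.sinh (2 * x)) *
      (k * Real.cosh (k * x) / Real.sinh (k * x) - 2 / Real.sinh (2 * x))) x := fun x hx ↦ by
    have hs : Real.sinh (k * x) ≠ 0 := (Real.sinh_pos_iff.2 (by positivity)).ne'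
    have hS : Real.sinh (2 * x) ≠ 0 := (Real.sinh_pos_iff.2 (by positivity)).ne'
    have h1 : HasDerivAt (fun x : ℝ ↦ k * x) k x := by simpa using (hasDerivAt_id x).const_mul k
    have h2 : HasDerivAt (fun x : ℝ ↦ 2 * x) 2 x := by
      simpa using (hasDerivAt_id x).const_mul (2 : ℝ)
    have h3 := ((((Real.hasDerivAt_sinh x).pow 2).const_mul (k ^ 2)).const_add 2).sub
      (((h2.sinh.const_mul k).mul h1.cosh).div h1.sinh hs)
    have h4 := (((h1.sinh.const_mul 2).div (h2.sinh.const_mul k)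
      (mul_ne_zero hk0.ne' hS)).log (div_ne_zero (mul_ne_zero two_ne_zero hs)
        (mul_ne_zero hk0.ne' hS))).const_mul 2
    refine (h3.sub h4).congr_deriv ?_
    have e3 := Real.sinh_two_mul x
    have e4 : (k ^ 2 * (((2 : ℕ) : ℝ) * Real.sinh x ^ (2 - 1) * Real.cosh x)) =
      k ^ 2 * Real.sinh (2 * x) := by rw [e3]; norm_num
    rw [e4]
    simp only [Pi.mul_apply, Pi.div_apply]
    field_simp
    ring
  have hnonneg : ∀ x : ℝ, 0 < x → 0 ≤ Real.sinh (2 * x) *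
      (k * Real.cosh (k * x) / Real.sinh (k * x) - 2 * Real.cosh (2 * x) / Real.sinh (2 * x)) *
      (k * Real.cosh (k * x) / Real.sinh (k * x) - 2 / Real.sinh (2 * x)) := fun x hx ↦ by
    have hs : 0 < Real.sinh (k * x) := Real.sinh_pos_iff.2 (by positivity)
    have hS : 0 < Real.sinh (2 * x) := Real.sinh_pos_iff.2 (by positivity)
    have h1 : 2 * Real.cosh (2 * x) / Real.sinh (2 * x) ≤
        k * Real.cosh (k * x) / Real.sinh (k * x) := by
      rw [div_le_div_iff₀ hS hs]
      exact two_mul_cosh_mul_sinh_le hk hx.le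
    have h2 : 2 / Real.sinh (2 * x) ≤ 2 * Real.cosh (2 * x) / Real.sinh (2 * x) := by
      gcongr
      linarith [Real.one_le_cosh (2 * x)]
    exact mul_nonneg (mul_nonneg hS.le (by linarith)) (by linarith)
  have hmono : MonotoneOn H (Ioi 0) := monotoneOn_of_deriv_nonneg (convex_Ioi 0)
    (fun x hx ↦ (hderiv x hx).continuousAt.continuousWithinAt)
    (fun x hx ↦ (hderiv x (interior_subset hx)).differentiableAt.differentiableWithinAt)
    (fun x hx ↦ by
      rw [(hderiv x (interior_subset hx)).deriv]
      exact hnonneg x (interior_subset hx))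
  have hratio : Tendsto (fun t : ℝ ↦ Real.sinh (k * t) / t / (Real.sinh (2 * t) / t)) (𝓝[>] 0)
      (𝓝 (k / 2)) :=
    (tendsto_sinh_mul_div_self k).div (tendsto_sinh_mul_div_self 2) two_ne_zero
  have hlim : Tendsto (fun t : ℝ ↦ 2 + k ^ 2 * Real.sinh t ^ 2 - k * Real.cosh (k * t) /
      (Real.sinh (k * t) / t / (Real.sinh (2 * t) / t)) -
      2 * Real.log (2 / k * (Real.sinh (k * t) / t / (Real.sinh (2 * t) / t)))) (𝓝[>] 0)
      (𝓝 (2 + k ^ 2 * Real.sinh 0 ^ 2 - k * Real.cosh (k * 0) / (k / 2) -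
        2 * Real.log (2 / k * (k / 2)))) := by
    refine Tendsto.sub (Tendsto.sub ?_ (Tendsto.div ?_ hratio (by positivity)))
      ((Tendsto.log (hratio.const_mul _) (by positivity)).const_mul 2)
    · exact ((by fun_prop : Continuous fun t : ℝ ↦ 2 + k ^ 2 * Real.sinh t ^ 2).tendsto
        0).mono_left nhdsWithin_le_nhds
    · exact ((by fun_prop : Continuous fun t : ℝ ↦ k * Real.cosh (k * t)).tendsto
        0).mono_left nhdsWithin_le_nhds
  have hzero : 2 + k ^ 2 * Real.sinh 0 ^ 2 - k * Real.cosh (k * 0) / (k / 2) -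
        2 * Real.log (2 / k * (k / 2)) = 0 := by
    have h : 2 / k * (k / 2) = 1 := by field_simp
    rw [h]
    simp
    field_simp
    ring
  rw [hzero] at hlim
  have hHt : 0 ≤ H t := by
    refine le_of_tendsto hlim ?_
    filter_upwards [Ioc_mem_nhdsGT ht] with x hx
    have hx0 : 0 < x := hx.1
    have hS : Real.sinh (2 * x) ≠ 0 := (Real.sinh_pos_iff.2 (by positivity)).ne'
    refine le_trans (le_of_eq ?_) (hmono hx0 ht hx.2)
    rw [div_div_div_cancel_right₀ hx0.ne', div_mul_div_comm, div_div_eq_mul_div]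
    simp only [hH]
    ring_nf
  simp only [hH] at hHt
  linarith

/-- A radial barrier: `A - |x|² / (2d) - B |x|^(2p)` is a supersolution of `Δv = -1` vanishing on
the boundary of the annulus. -/
theorem exists_radial_barrier {d r R : ℝ} (hd : 2 ≤ d) (hr : 0 < r) (hrR : r < R) :
    ∃ A B p : ℝ, 0 ≤ B ∧ 0 ≤ p * (2 * p - 2 + d) ∧
      0 ≤ A - r ^ 2 / (2 * d) - B * (r ^ 2) ^ p ∧ 0 ≤ A - R ^ 2 / (2 * d) - B * (R ^ 2) ^ p ∧
      ∀ s : ℝ, 0 < s → A - s ^ 2 / (2 * d) - B * (s ^ 2) ^ p ≤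
        max (1 / (2 * d)) (1 / 8) * (R - r) ^ 2 := by
  have hR : 0 < R := hr.trans hrR
  rcases le_total d 4 with hd4 | hd4
  · refine ⟨(r ^ 2 + R ^ 2) / (2 * d), r ^ 2 * R ^ 2 / (2 * d), -1, by positivity, by linarith,
      ?_, ?_, fun s hs ↦ ?_⟩
    · rw [Real.rpow_neg_one]
      refine le_of_eq ?_
      field_simp
      ring
    · rw [Real.rpow_neg_one]
      refine le_of_eq ?_
      field_simp
      ring
    · rw [Real.rpow_neg_one]
      refine le_trans ?_ (mul_le_mul_of_nonneg_right (le_max_left _ _) (sq_nonneg _))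
      have h : (r ^ 2 + R ^ 2) / (2 * d) - s ^ 2 / (2 * d) - r ^ 2 * R ^ 2 / (2 * d) * (s ^ 2)⁻¹ =
          1 / (2 * d) * ((R - r) ^ 2 - (s - r * R / s) ^ 2) := by
        field_simp
        ring
      rw [h]
      gcongr
      linarith [sq_nonneg (s - r * R / s)]
  · obtain ⟨k, rfl⟩ : ∃ k, d = k + 2 := ⟨d - 2, by ring⟩
    have hk : 2 ≤ k := by linarith
    have hk0 : 0 < k := by linarith
    obtain ⟨g, t, ht, rfl, rfl⟩ : ∃ g t : ℝ, 0 < t ∧ r = Real.exp (g - t) ∧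
        R = Real.exp (g + t) := by
      refine ⟨(Real.log R + Real.log r) / 2, (Real.log R - Real.log r) / 2, ?_, ?_, ?_⟩
      · linarith [Real.log_lt_log hr hrR]
      · rw [show (Real.log R + Real.log r) / 2 - (Real.log R - Real.log r) / 2 = Real.log r by ring,
          Real.exp_log hr]
      · rw [show (Real.log R + Real.log r) / 2 + (Real.log R - Real.log r) / 2 = Real.log R by ring,
          Real.exp_log hR]
    have hs : 0 < Real.sinh (k * t) := Real.sinh_pos_iff.2 (by positivity)
    have hS : 0 < Real.sinh (2 * t) := Real.sinh_pos_iff.2 (by positivity)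
    have hsq : ∀ x : ℝ, Real.exp (g + x) ^ 2 = Real.exp g ^ 2 * Real.exp (2 * x) := fun x ↦ by
      rw [← Real.exp_nat_mul, ← Real.exp_nat_mul, ← Real.exp_add]
      push_cast
      ring_nf
    have hpow : ∀ x : ℝ, Real.exp ((k + 2) * g) * (Real.exp (g + x) ^ 2) ^ (-k / 2) =
        Real.exp g ^ 2 * Real.exp (-(k * x)) := fun x ↦ by
      rw [← Real.exp_nat_mul, ← Real.exp_nat_mul, ← Real.exp_mul, ← Real.exp_add, ← Real.exp_add]
      push_cast
      ring_nf
    set K := Real.sinh (2 * t) / Real.sinh (k * t) with hK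
    have hKpos : 0 < K := div_pos hS hs
    have hval : ∀ x : ℝ, Real.exp g ^ 2 * (Real.cosh (2 * t) + K * Real.cosh (k * t)) /
          (2 * (k + 2)) - Real.exp (g + x) ^ 2 / (2 * (k + 2)) -
        Real.exp ((k + 2) * g) * K / (2 * (k + 2)) * (Real.exp (g + x) ^ 2) ^ (-k / 2) =
        Real.exp g ^ 2 / (2 * (k + 2)) * (Real.cosh (2 * t) + K * Real.cosh (k * t) -
          Real.exp (2 * x) - K * Real.exp (-(k * x))) := fun x ↦ by
      rw [show Real.exp ((k + 2) * g) * K / (2 * (k + 2)) * (Real.exp (g + x) ^ 2) ^ (-k / 2) =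
        K / (2 * (k + 2)) * (Real.exp ((k + 2) * g) * (Real.exp (g + x) ^ 2) ^ (-k / 2)) by ring,
        hpow, hsq]
      ring
    have hKs : K * Real.sinh (k * t) = Real.sinh (2 * t) := div_mul_cancel₀ _ hs.ne'
    refine ⟨Real.exp g ^ 2 * (Real.cosh (2 * t) + K * Real.cosh (k * t)) / (2 * (k + 2)),
      Real.exp ((k + 2) * g) * K / (2 * (k + 2)), -k / 2, by positivity, le_of_eq (by ring),
      ?_, ?_, fun s hs0 ↦ ?_⟩
    · rw [sub_eq_add_neg g t, hval]
      refine le_of_eq ?_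
      rw [show -(k * -t) = k * t by ring, show 2 * -t = -(2 * t) by ring,
        ← Real.cosh_add_sinh (k * t), ← Real.cosh_sub_sinh (2 * t)]
      linear_combination (Real.exp g ^ 2 / (2 * (k + 2))) * hKs
    · rw [hval]
      refine le_of_eq ?_
      rw [← Real.cosh_add_sinh (2 * t), ← Real.cosh_sub_sinh (k * t)]
      linear_combination -(Real.exp g ^ 2 / (2 * (k + 2))) * hKs
    · obtain ⟨x, rfl⟩ : ∃ x, s = Real.exp (g + x) :=
        ⟨Real.log s - g, by rw [add_sub_cancel, Real.exp_log hs0]⟩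
      rw [hval]
      refine le_trans ?_ (mul_le_mul_of_nonneg_right (le_max_right _ _) (sq_nonneg _))
      have hRr : (Real.exp (g + t) - Real.exp (g - t)) ^ 2 =
          Real.exp g ^ 2 * (4 * Real.sinh t ^ 2) := by
        rw [sub_eq_add_neg g t, Real.exp_add, Real.exp_add, Real.sinh_eq]
        ring
      have hlog : Real.log (2 * Real.sinh (k * t) / (k * Real.sinh (2 * t))) =
          -Real.log (k * K / 2) := by
        rw [← Real.log_inv, hK]
        congr 1
        field_simp
      have hmain := sinh_mul_coth_add_log_le hk ht
      rw [hlog, show k * Real.sinh (2 * t) * Real.cosh (k * t) / Real.sinh (k * t) =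
        k * (K * Real.cosh (k * t)) by rw [hK]; ring] at hmain
      have h1 := Real.add_one_le_exp (2 * x)
      have h2 := Real.add_one_le_exp (Real.log (k * K / 2) + -(k * x))
      rw [Real.exp_add, Real.exp_log (by positivity)] at h2
      have hC : Real.cosh (2 * t) = 1 + 2 * Real.sinh t ^ 2 := by
        rw [Real.cosh_two_mul, Real.cosh_sq]; ring
      have hfin : Real.cosh (2 * t) + K * Real.cosh (k * t) - Real.exp (2 * x) -
          K * Real.exp (-(k * x)) ≤ (k + 2) * Real.sinh t ^ 2 := by
        refine le_of_mul_le_mul_left ?_ hk0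
        rw [hC]
        nlinarith
      rw [hRr]
      calc _ ≤ Real.exp g ^ 2 / (2 * (k + 2)) * ((k + 2) * Real.sinh t ^ 2) := by gcongr
        _ = _ := by field_simp; ring

/-- A one-sided estimate for the Dirichlet problem on a single annulus. -/
theorem le_of_neg_le_laplacian_annulus {d : ℕ} (hd : 2 ≤ d) {r R M : ℝ} (hr : 0 < r) (hrR : r < R)
    (hM : 0 ≤ M) {f : EuclideanSpace ℝ (Fin d) → ℝ}
    (hcont : ContinuousOn f (closedAnnulus d r R)) (hdiff : ContDiffOn ℝ 2 f (annulus d r R))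
    (hbdry : ∀ x, ‖x‖ = r ∨ ‖x‖ = R → f x = 0) (hlap : ∀ x ∈ annulus d r R, -M ≤ laplacian f x)
    {x : EuclideanSpace ℝ (Fin d)} (hx : x ∈ closedAnnulus d r R) :
    f x ≤ max (1 / (2 * (d : ℝ))) (1 / 8) * (R - r) ^ 2 * M := by
  obtain ⟨A, B, p, hB, hp, hAr, hAR, hle⟩ :=
    exists_radial_barrier (d := d) (by exact_mod_cast hd) hr hrR
  set v : EuclideanSpace ℝ (Fin d) → ℝ :=
    fun y ↦ A - ‖y‖ ^ 2 / (2 * d) - B * (‖y‖ ^ 2) ^ p with hv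
  have hne : ∀ y ∈ closedAnnulus d r R, y ≠ 0 := fun y hy ↦ norm_pos_iff.1 (hr.trans_le hy.1)
  have hvdiff : ∀ y ∈ closedAnnulus d r R, ContDiffAt ℝ 2 v y :=
    fun y hy ↦ contDiffAt_radial_barrier A B p (hne y hy)
  have hcompare : ∀ M' > M, f x ≤ M' * v x := fun M' hM' ↦ by
    have hucont : ContinuousOn (fun y ↦ f y - M' * v y) (closedAnnulus d r R) :=
      hcont.sub (continuousOn_const.mul
        fun y hy ↦ (hvdiff y hy).continuousAt.continuousWithinAt)
    obtain ⟨y, hy, hymax⟩ := (isCompact_closedAnnulus d r R).exists_isMaxOn ⟨x, hx⟩ hucont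
    suffices h : f y - M' * v y ≤ 0 by
      have := hymax hx
      simp only [mem_ofPred_eq] at this
      linarith
    by_cases hbd : ‖y‖ = r ∨ ‖y‖ = R
    · have hvy : 0 ≤ v y := by
        simp only [hv]
        rcases hbd with h | h <;> rw [h] <;> assumption
      rw [hbdry y hbd]
      nlinarith
    · push Not at hbd
      have hyo : y ∈ annulus d r R :=
        ⟨lt_of_le_of_ne hy.1 (Ne.symm hbd.1), lt_of_le_of_ne hy.2 hbd.2⟩
      have hnhds := (isOpen_annulus d r R).mem_nhds hyo
      have hfy : ContDiffAt ℝ 2 f y := hdiff.contDiffAt hnhds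
      have hmulv : ContDiffAt ℝ 2 (fun z ↦ M' * v z) y := contDiffAt_const.mul (hvdiff y hy)
      have hlocMax := hymax.isLocalMax (mem_of_superset hnhds (annulus_subset_closedAnnulus d r R))
      have hnonpos := laplacian_nonpos_of_isLocalMax (hfy.sub hmulv) hlocMax
      rw [laplacian_sub hfy hmulv, laplacian_const_mul (hvdiff y hy),
        laplacian_radial_barrier (by omega) A B p (hne y hy)] at hnonpos
      have hpos : 0 ≤ 2 * B * (p * (2 * p - 2 + d)) * (‖y‖ ^ 2) ^ (p - 1) := by positivity
      have := hlap y hyo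
      nlinarith
  have hlim : f x ≤ M * v x := by
    have htend : Tendsto (fun M' ↦ M' * v x) (𝓝[>] M) (𝓝 (M * v x)) :=
      ((continuous_id.mul continuous_const).tendsto M).mono_left nhdsWithin_le_nhds
    exact ge_of_tendsto htend (eventually_nhdsWithin_of_forall hcompare)
  calc f x ≤ M * v x := hlim
    _ ≤ M * (max (1 / (2 * (d : ℝ))) (1 / 8) * (R - r) ^ 2) := by
      gcongr
      exact hle ‖x‖ (hr.trans_le hx.1)
    _ = _ := by ring

/-- The Laplacian of a `C²` function on a compact set is bounded on any open subset. -/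
theorem exists_abs_laplacian_le {d : ℕ} {f : EuclideanSpace ℝ (Fin d) → ℝ}
    {U K : Set (EuclideanSpace ℝ (Fin d))} (hU : IsOpen U) (hK : IsCompact K) (hUK : U ⊆ K)
    (hf : ContDiffOn ℝ 2 f K) : ∃ M, ∀ x ∈ U, |laplacian f x| ≤ M := by
  suffices h : ∃ M, ∀ x ∈ K, x ∈ U → |laplacian f x| ≤ M from
    h.imp fun M hM x hx ↦ hM x (hUK hx) hx
  refine hK.induction_on (p := fun s ↦ ∃ M, ∀ x ∈ s, x ∈ U → |laplacian f x| ≤ M)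
    ⟨0, by simp⟩ (fun s t hst ⟨M, hM⟩ ↦ ⟨M, fun x hx ↦ hM x (hst hx)⟩)
    (fun s t ⟨M, hM⟩ ⟨N, hN⟩ ↦ ⟨max M N, fun x hx hxU ↦ hx.elim
      (fun h ↦ (hM x h hxU).trans (le_max_left _ _))
      (fun h ↦ (hN x h hxU).trans (le_max_right _ _))⟩) fun x hx ↦ ?_
  obtain ⟨u, hu, p, hp⟩ := contDiffWithinAt_nat.1 (hf x hx)
  rw [insert_eq_of_mem hx] at hu
  have hcont : ContinuousWithinAt (fun y ↦ ‖∑ i : Fin d, p y 2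
      ![EuclideanSpace.single i 1, EuclideanSpace.single i 1]‖) u x := by
    refine (tendsto_finsetSum _ fun i _ ↦ ?_).norm
    have h2 := hp.cont 2 le_rfl x (mem_of_mem_nhdsWithin hx hu)
    exact ((ContinuousMultilinearMap.apply ℝ _ ℝ _).continuous.tendsto _).comp h2
  have hle : 𝓝[K] x ≤ 𝓝[u] x := nhdsWithin_le_of_mem hu
  have hev := hle (hcont.eventually (gt_mem_nhds (lt_add_one _)))
  obtain ⟨o, ho, hxo, hou⟩ := mem_nhdsWithin.1 hu
  refine ⟨_, inter_mem hev (inter_mem_nhdsWithin K (ho.mem_nhds hxo)), _,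
    fun y hy hyU ↦ le_of_eq_of_le ?_ hy.1.le⟩
  have hopen : IsOpen (o ∩ U) := ho.inter hU
  have hpy := (hp.mono ((inter_subset_inter_right o hUK).trans
    hou)).eq_iteratedFDerivWithin_of_uniqueDiffOn (m := 2) le_rfl hopen.uniqueDiffOn ⟨hy.2.2, hyU⟩
  rw [iteratedFDerivWithin_of_isOpen 2 hopen ⟨hy.2.2, hyU⟩] at hpy
  rw [hpy, Real.norm_eq_abs, laplacian]

theorem exists_fin_mem_Icc {n : ℕ} (hn : 1 ≤ n) {r : Fin (n + 1) → ℝ} {t : ℝ} (h0 : r 0 ≤ t)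
    (hlast : t ≤ r (Fin.last n)) : ∃ i : Fin n, r i.castSucc ≤ t ∧ t ≤ r i.succ := by
  by_contra! h
  have hall : ∀ j : Fin (n + 1), r j ≤ t :=
    Fin.induction h0 fun i hi ↦ (h i hi).le
  obtain ⟨m, rfl⟩ : ∃ m, n = m + 1 := ⟨n - 1, by omega⟩
  have := h (Fin.last m) (hall _)
  rw [Fin.succ_last] at this
  linarith

/-- Error estimate in the supremum norm for interpolation by harmonic splines
on an annulus with concentric annular partition. -/
theorem harmonic_spline_sup_error
    (d n : ℕ) (hd : 2 ≤ d) (hn : 1 ≤ n) (r : Fin (n + 1) → ℝ)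
    (hr0 : 0 < r 0) (hr : StrictMono r)
    (F S : EuclideanSpace ℝ (Fin d) → ℝ)
    (hF : ContDiffOn ℝ 2 F (closedAnnulus d (r 0) (r (Fin.last n))))
    (hS : HarmonicSpline d n r S)
    (hinterp : ∀ (i : Fin (n + 1)) (x : EuclideanSpace ℝ (Fin d)), ‖x‖ = r i → S x = F x) :
    (⨆ x ∈ annulus d (r 0) (r (Fin.last n)), |F x - S x|) ≤
      max (1 / (2 * (d : ℝ))) (1 / 8) *
        (⨆ i : Fin n, (r i.succ - r i.castSucc) ^ 2) *
        (⨆ x ∈ annulus d (r 0) (r (Fin.last n)), |laplacian F x|) := by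
  set M := ⨆ x ∈ annulus d (r 0) (r (Fin.last n)), |laplacian F x| with hMdef
  have hM : 0 ≤ M := Real.iSup_nonneg fun x ↦ Real.iSup_nonneg fun _ ↦ abs_nonneg _
  have hlap : ∀ x ∈ annulus d (r 0) (r (Fin.last n)), |laplacian F x| ≤ M := fun x hx ↦ by
    obtain ⟨N, hN⟩ := exists_abs_laplacian_le (isOpen_annulus d (r 0) (r (Fin.last n)))
      (isCompact_closedAnnulus d _ _) (annulus_subset_closedAnnulus d _ _) hF
    have hN0 : 0 ≤ N := (abs_nonneg _).trans (hN x hx)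
    have hbdd : BddAbove (range fun x ↦ ⨆ _ : x ∈ annulus d (r 0) (r (Fin.last n)),
        |laplacian F x|) :=
      ⟨N, forall_mem_range.2 fun y ↦ Real.iSup_le (fun hy ↦ hN y hy) hN0⟩
    refine le_trans (le_of_eq ?_) (le_ciSup hbdd x)
    have : Nonempty (x ∈ annulus d (r 0) (r (Fin.last n))) := ⟨hx⟩
    exact (ciSup_const).symm
  set L := ⨆ i : Fin n, (r i.succ - r i.castSucc) ^ 2 with hL
  have hL0 : 0 ≤ L := Real.iSup_nonneg fun i ↦ sq_nonneg _
  have hC0 : 0 ≤ max (1 / (2 * (d : ℝ))) (1 / 8) := le_max_of_le_right (by norm_num)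
  have hbound : 0 ≤ max (1 / (2 * (d : ℝ))) (1 / 8) * L * M := by positivity
  refine Real.iSup_le (fun x ↦ Real.iSup_le (fun hx ↦ ?_) hbound) hbound
  obtain ⟨i, hi⟩ := exists_fin_mem_Icc hn hx.1.le hx.2.le
  have hri : r i.castSucc < r i.succ := hr i.castSucc_lt_succ
  have hri0 : r 0 ≤ r i.castSucc := hr.monotone (Fin.zero_le _)
  have hrin : r i.succ ≤ r (Fin.last n) := hr.monotone (Fin.le_last _)
  have hclosed : closedAnnulus d (r i.castSucc) (r i.succ) ⊆
      closedAnnulus d (r 0) (r (Fin.last n)) := fun y hy ↦ ⟨hri0.trans hy.1, hy.2.trans hrin⟩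
  have hopen : annulus d (r i.castSucc) (r i.succ) ⊆ annulus d (r 0) (r (Fin.last n)) :=
    fun y hy ↦ ⟨hri0.trans_lt hy.1, hy.2.trans_le hrin⟩
  have hFi := hF.mono ((annulus_subset_closedAnnulus d _ _).trans hclosed)
  obtain ⟨hSi, hSharm⟩ := hS.2 i
  have hFat : ∀ y ∈ annulus d (r i.castSucc) (r i.succ), ContDiffAt ℝ 2 F y :=
    fun y hy ↦ hFi.contDiffAt ((isOpen_annulus d _ _).mem_nhds hy)
  have hSat : ∀ y ∈ annulus d (r i.castSucc) (r i.succ), ContDiffAt ℝ 2 S y :=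
    fun y hy ↦ hSi.contDiffAt ((isOpen_annulus d _ _).mem_nhds hy)
  have hFc := hF.continuousOn.mono hclosed
  have hSc := hS.1.mono hclosed
  have heq : ∀ y : EuclideanSpace ℝ (Fin d), ‖y‖ = r i.castSucc ∨ ‖y‖ = r i.succ → S y = F y :=
    fun y hy ↦ hy.elim (hinterp _ y) (hinterp _ y)
  have hpos : 0 < r i.castSucc := hr0.trans_le hri0
  have hmain : |F x - S x| ≤
      max (1 / (2 * (d : ℝ))) (1 / 8) * (r i.succ - r i.castSucc) ^ 2 * M := by
    refine abs_sub_le_iff.2 ⟨?_, ?_⟩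
    · refine le_of_neg_le_laplacian_annulus (f := fun y ↦ F y - S y) hd hpos hri hM (hFc.sub hSc)
        (hFi.sub hSi) (fun y hy ↦ sub_eq_zero.2 (heq y hy).symm) (fun y hy ↦ ?_) hi
      rw [laplacian_sub (hFat y hy) (hSat y hy), hSharm y hy]
      linarith [(abs_le.1 (hlap y (hopen hy))).1]
    · refine le_of_neg_le_laplacian_annulus (f := fun y ↦ S y - F y) hd hpos hri hM (hSc.sub hFc)
        (hSi.sub hFi) (fun y hy ↦ sub_eq_zero.2 (heq y hy)) (fun y hy ↦ ?_) hi
      rw [laplacian_sub (hSat y hy) (hFat y hy), hSharm y hy]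
      linarith [(abs_le.1 (hlap y (hopen hy))).2]
  refine hmain.trans ?_
  gcongr
  exact le_ciSup (f := fun i : Fin n ↦ (r i.succ - r i.castSucc) ^ 2) (finite_range _).bddAbove i
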